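/- Let Ω ⊂ ℝ^d (d ≥ 2) be a smooth, bounded, uniformly convex open domain. Then λ_MA = inf_{u ∈ 𝒦} R(u), where 𝒦 = {u ∈ C^{0,1}(cl Ω) ∩ C^∞(Ω) : u is convex and nonzero in Ω, u = 0 on ∂Ω}. -/

import Mathlib

open MeasureTheory

/-- The Hessian matrix of `u : ℝ^d → ℝ` at `x`, whose `(i,j)` entry is `∂²u/∂xᵢ∂xⱼ (x)`. -/
noncomputable def hessian (d : ℕ) (u : EuclideanSpace ℝ (Fin d) → ℝ)
    (x : EuclideanSpace ℝ (Fin d)) : Matrix (Fin d) (Fin d) ℝ :=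
  Matrix.of fun i j =>
    fderiv ℝ (fun y => fderiv ℝ u y (EuclideanSpace.single j 1)) x (EuclideanSpace.single i 1)

/-- The Rayleigh quotient of `u` for the Monge–Ampère operator on `Ω ⊆ ℝ^d`:
`R(u) = (∫_Ω (−u) det(D²u) dx) / (∫_Ω (−u)^(d+1) dx)`. -/
noncomputable def rayleigh (d : ℕ) (Ω : Set (EuclideanSpace ℝ (Fin d)))
    (u : EuclideanSpace ℝ (Fin d) → ℝ) : ℝ :=
  (∫ x in Ω, (-u x) * (hessian d u x).det) / (∫ x in Ω, (-u x) ^ (d + 1))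

/-- `Ω ⊆ ℝ^d` is a smooth, bounded, uniformly convex open domain: it is nonempty, open,
bounded, convex, and is the strict sublevel set of a globally smooth, uniformly convex
defining function. -/
def SmoothBoundedUniformlyConvexDomain (d : ℕ) (Ω : Set (EuclideanSpace ℝ (Fin d))) : Prop :=
  IsOpen Ω ∧ Bornology.IsBounded Ω ∧ Ω.Nonempty ∧ Convex ℝ Ω ∧
    ∃ (φ : EuclideanSpace ℝ (Fin d) → ℝ) (c : ℝ), 0 < c ∧ ContDiff ℝ (⊤ : ℕ∞) φ ∧
      Ω = {x | φ x < 0} ∧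
      ∀ (x v : EuclideanSpace ℝ (Fin d)),
        c * ‖v‖ ^ 2 ≤ fderiv ℝ (fun y => fderiv ℝ φ y v) x v

/-- The admissible class `𝒦 = {u ∈ C^{0,1}(cl Ω) ∩ C^∞(Ω) : u` convex and nonzero in `Ω`,
`u = 0` on `∂Ω}`. -/
def admissibleK (d : ℕ) (Ω : Set (EuclideanSpace ℝ (Fin d))) :
    Set (EuclideanSpace ℝ (Fin d) → ℝ) :=
  {u | (∃ K : NNReal, LipschitzOnWith K u (closure Ω)) ∧ ContDiffOn ℝ (⊤ : ℕ∞) u Ω ∧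
       ConvexOn ℝ Ω u ∧ (∃ x ∈ Ω, u x ≠ 0) ∧ (∀ x ∈ frontier Ω, u x = 0)}

/-- `(lam, u)` is a Monge–Ampère eigenpair of `Ω`: `u` is a nonzero convex function,
continuous up to the boundary and smooth inside, with `det(D²u) = lam |u|^d` in `Ω` and
`u = 0` on `∂Ω`. -/
def IsMAEigenpair (d : ℕ) (Ω : Set (EuclideanSpace ℝ (Fin d))) (lam : ℝ)
    (u : EuclideanSpace ℝ (Fin d) → ℝ) : Prop :=
  ContinuousOn u (closure Ω) ∧ ContDiffOn ℝ (⊤ : ℕ∞) u Ω ∧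
  ConvexOn ℝ (closure Ω) u ∧ (∃ x ∈ closure Ω, u x ≠ 0) ∧
  (∀ x ∈ Ω, (hessian d u x).det = lam * |u x| ^ d) ∧
  (∀ x ∈ frontier Ω, u x = 0)

section Calculus

open Set Filter Topology
open scoped Gradient RealInnerProductSpace

/-- A convex function lies above its tangent planes. -/
theorem ConvexOn.add_fderiv_le {F : Type*} [NormedAddCommGroup F] [NormedSpace ℝ F]
    {s : Set F} {u : F → ℝ} {u' : F →L[ℝ] ℝ} {x y : F} (hu : ConvexOn ℝ s u)
    (hx : x ∈ s) (hy : y ∈ s) (hd : HasFDerivAt u u' x) :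
    u x + u' (y - x) ≤ u y := by
  have hline : HasDerivAt (fun r : ℝ => AffineMap.lineMap x y r) (y - x) (0 : ℝ) :=
    AffineMap.hasDerivAt_lineMap
  have hd' : HasDerivAt (fun r : ℝ => u (AffineMap.lineMap x y r)) (u' (y - x)) 0 := by
    refine HasFDerivAt.comp_hasDerivAt (l := u) (0 : ℝ) ?_ hline
    simpa using hd
  have hc : ConvexOn ℝ (AffineMap.lineMap (k := ℝ) x y ⁻¹' s)
      (fun r : ℝ => u (AffineMap.lineMap x y r)) := hu.comp_affineMap _
  have h := hc.le_slope_of_hasDerivAt (x := 0) (y := 1) (by simpa using hx) (by simpa using hy)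
    zero_lt_one hd'
  simp [slope] at h
  rw [map_sub]
  linarith

theorem ContDiffAt.differentiableAt_fderiv {F : Type*} [NormedAddCommGroup F] [NormedSpace ℝ F]
    {u : F → ℝ} {x : F} (hu : ContDiffAt ℝ 2 u x) : DifferentiableAt ℝ (fderiv ℝ u) x :=
  (hu.fderiv_right (m := 1) one_add_one_eq_two.le).differentiableAt one_ne_zero

/-- The second derivative of a `C²` function is nonnegative at a local minimum. -/
theorem IsLocalMin.fderiv_fderiv_nonneg {F : Type*} [NormedAddCommGroup F] [NormedSpace ℝ F]
    {u : F → ℝ} {x : F} (hmin : IsLocalMin u x) (hu : ContDiffAt ℝ 2 u x) (v : F) :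
    0 ≤ fderiv ℝ (fderiv ℝ u) x v v := by
  by_contra! hneg
  have hline : ∀ r : ℝ, HasDerivAt (fun r : ℝ => x + r • v) v r := fun r => by
    simpa using ((hasDerivAt_id r).smul_const v).const_add x
  have hcont : Tendsto (fun r : ℝ => x + r • v) (𝓝 0) (𝓝 x) := by
    simpa using (hline 0).continuousAt.tendsto
  have hdiff : ∀ᶠ y in 𝓝 x, DifferentiableAt ℝ u y :=
    (hu.eventually (by simp)).mono fun y hy => hy.differentiableAt (by simp)
  have h1 : ∀ᶠ r in 𝓝 (0 : ℝ),
      HasDerivAt (fun r : ℝ => u (x + r • v)) (fderiv ℝ u (x + r • v) v) r :=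
    (hcont.eventually hdiff).mono fun r hr => hr.hasFDerivAt.comp_hasDerivAt r (hline r)
  have hD : DifferentiableAt ℝ (fderiv ℝ u) (x + (0 : ℝ) • v) := by
    rw [zero_smul, add_zero]
    exact hu.differentiableAt_fderiv
  have h2 : HasDerivAt (fun r : ℝ => fderiv ℝ u (x + r • v) v) (fderiv ℝ (fderiv ℝ u) x v v) 0 := by
    have h := hD.hasFDerivAt.comp_hasDerivAt (0 : ℝ) (hline 0)
    rw [zero_smul, add_zero] at h
    have h' := (ContinuousLinearMap.apply ℝ ℝ v).hasFDerivAt.comp_hasDerivAt (0 : ℝ) h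
    exact h'
  have h3 : deriv (fun r : ℝ => u (x + r • v)) =ᶠ[𝓝 0] fun r : ℝ => fderiv ℝ u (x + r • v) v :=
    h1.mono fun r hr => hr.deriv
  have hmin' : IsLocalMin (fun r : ℝ => u (x + r • v)) 0 := by
    have := hcont.eventually hmin
    simpa [IsLocalMin, IsMinFilter] using this
  have hmax : IsLocalMax (fun r : ℝ => u (x + r • v)) 0 := by
    refine isLocalMax_of_deriv_deriv_neg ?_ hmin'.deriv_eq_zero h1.self_of_nhds.continuousAt
    rwa [h3.deriv_eq, h2.deriv]
  have hconst : (fun r : ℝ => u (x + r • v)) =ᶠ[𝓝 0] fun _ => u (x + (0 : ℝ) • v) := by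
    filter_upwards [hmin', hmax] with r h h' using le_antisymm h' h
  have h4 := h2.deriv
  rw [← h3.deriv_eq, hconst.deriv.deriv_eq] at h4
  simp at h4
  linarith

/-- The second derivative of a smooth convex function is nonnegative. -/
theorem ConvexOn.fderiv_fderiv_nonneg {F : Type*} [NormedAddCommGroup F] [NormedSpace ℝ F]
    {s : Set F} {u : F → ℝ} {x : F} (hu : ConvexOn ℝ s u) (hs : s ∈ 𝓝 x)
    (hd : ContDiffAt ℝ 2 u x) (v : F) :
    0 ≤ fderiv ℝ (fderiv ℝ u) x v v := by
  set ℓ := fderiv ℝ u x with hℓ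
  have hdx : DifferentiableAt ℝ u x := hd.differentiableAt (by simp)
  have hmin : IsLocalMin (fun y => u y - ℓ y) x := by
    filter_upwards [hs] with y hy
    have := hu.add_fderiv_le (mem_of_mem_nhds hs) hy hdx.hasFDerivAt
    rw [map_sub] at this
    linarith
  have h := hmin.fderiv_fderiv_nonneg (hd.sub ℓ.contDiff.contDiffAt) v
  have heq : fderiv ℝ (fun y => u y - ℓ y) =ᶠ[𝓝 x] fun y => fderiv ℝ u y - ℓ := by
    filter_upwards [hd.eventually (by simp)] with y hy
    rw [fderiv_fun_sub (hy.differentiableAt (by simp)) ℓ.differentiableAt, ℓ.fderiv]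
  rw [heq.fderiv_eq, fderiv_sub_const] at h
  exact h

section Gradient

variable {F : Type*} [NormedAddCommGroup F] [InnerProductSpace ℝ F] [CompleteSpace F]

theorem ContDiffAt.differentiableAt_gradient {u : F → ℝ} {x : F} (hu : ContDiffAt ℝ 2 u x) :
    DifferentiableAt ℝ (∇ u) x := by
  have h := hu.differentiableAt_fderiv
  exact (InnerProductSpace.toDual ℝ F).symm.toContinuousLinearEquiv.differentiableAt.comp x h

theorem ContDiffAt.inner_fderiv_gradient {u : F → ℝ} {x : F} (hu : ContDiffAt ℝ 2 u x)
    (v w : F) : ⟪fderiv ℝ (∇ u) x v, w⟫ = fderiv ℝ (fderiv ℝ u) x v w := by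
  have h := hu.differentiableAt_fderiv
  have := ((InnerProductSpace.toDual ℝ F).symm.toContinuousLinearEquiv.hasFDerivAt).comp x
    h.hasFDerivAt
  have h2 : HasFDerivAt (∇ u) _ x := this
  rw [h2.fderiv]
  simp

/-- The gradient of a convex function is injective where the Hessian is invertible. -/
theorem ConvexOn.eq_of_gradient_eq {s : Set F} {u : F → ℝ} {x y : F} (hu : ConvexOn ℝ s u)
    (hs : IsOpen s) (hd : ContDiffOn ℝ 2 u s) (hx : x ∈ s) (hy : y ∈ s)
    (hxy : ∇ u x = ∇ u y) (hinj : Function.Injective (fderiv ℝ (∇ u) x)) : x = y := by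
  have hda : ∀ z ∈ s, HasFDerivAt u (fderiv ℝ u z) z := fun z hz =>
    ((hd.contDiffAt (hs.mem_nhds hz)).differentiableAt (by simp)).hasFDerivAt
  have hxy' : fderiv ℝ u x = fderiv ℝ u y := by
    rw [← toDual_gradient, ← toDual_gradient, hxy]
  have hconst : ∀ r ∈ Icc (0 : ℝ) 1, ∇ u (AffineMap.lineMap x y r) = ∇ u x := by
    intro r hr
    set z := AffineMap.lineMap x y r with hz
    have hzs : z ∈ s := hu.1.lineMap_mem hx hy hr
    have hzx : z - x = r • (y - x) := by simp [hz, AffineMap.lineMap_apply]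
    have hmin : IsLocalMin (fun p => u p - fderiv ℝ u x p) z := by
      filter_upwards [hs.mem_nhds hzs] with p hp
      have h1 := hu.add_fderiv_le hx hp (hda x hx)
      have h2 := hu.add_fderiv_le hx hy (hda x hx)
      have h3 := hu.add_fderiv_le hy hx (hda y hy)
      rw [← hxy'] at h3
      have h4 := hu.2 hx hy (sub_nonneg.2 hr.2) hr.1 (by ring)
      have h5 : (1 - r) • x + r • y = z := by
        rw [hz, AffineMap.lineMap_apply_module]
      rw [h5] at h4
      have h6 : fderiv ℝ u x z = fderiv ℝ u x x + r * (fderiv ℝ u x y - fderiv ℝ u x x) := by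
        rw [← h5]; simp; ring
      simp only [map_sub, smul_eq_mul] at h1 h2 h3 h4
      have h7 : u y - u x = fderiv ℝ u x y - fderiv ℝ u x x := by linarith
      have h8 : u z ≤ u x + r * (u y - u x) := by linarith
      rw [h7] at h8
      linarith
    have h := hmin.fderiv_eq_zero
    rw [fderiv_fun_sub (hda z hzs).differentiableAt (ContinuousLinearMap.differentiableAt _),
      ContinuousLinearMap.fderiv, sub_eq_zero] at h
    simp [gradient, h]
  have hline : HasDerivAt (fun r : ℝ => AffineMap.lineMap x y r) (y - x) (0 : ℝ) :=
    AffineMap.hasDerivAt_lineMap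
  have hg : HasDerivAt (fun r : ℝ => ∇ u (AffineMap.lineMap x y r))
      (fderiv ℝ (∇ u) x (y - x)) 0 := by
    refine HasFDerivAt.comp_hasDerivAt (l := ∇ u) (0 : ℝ) ?_ hline
    simpa using (hd.contDiffAt (hs.mem_nhds hx)).differentiableAt_gradient.hasFDerivAt
  have hzero : fderiv ℝ (∇ u) x (y - x) = 0 := by
    have huniq : UniqueDiffWithinAt ℝ (Icc (0 : ℝ) 1) 0 :=
      uniqueDiffOn_Icc zero_lt_one 0 (by simp)
    have h1 := hg.hasDerivWithinAt (s := Icc (0 : ℝ) 1)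
    have h2 : HasDerivWithinAt (fun r : ℝ => ∇ u (AffineMap.lineMap x y r)) 0
        (Icc (0 : ℝ) 1) 0 :=
      (hasDerivWithinAt_const (0 : ℝ) _ (∇ u x)).congr (fun r hr => hconst r hr)
        (hconst 0 (by simp))
    exact huniq.eq_deriv _ h1 h2
  have := hinj (hzero.trans (map_zero _).symm)
  exact (sub_eq_zero.1 this).symm

end Gradient

end Calculus

section Domain

open Set Filter Topology Metric

/-- A ray issued from a point of a bounded open set meets the boundary. -/
theorem IsOpen.exists_add_smul_mem_frontier {F : Type*} [NormedAddCommGroup F] [NormedSpace ℝ F]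
    {s : Set F} (hs : IsOpen s) (hb : Bornology.IsBounded s) {x v : F} (hx : x ∈ s)
    (hv : v ≠ 0) : ∃ r : ℝ, 0 < r ∧ x + r • v ∈ frontier s := by
  set ray : Set F := (fun r : ℝ => x + r • v) '' Ici 0 with hray
  have hpre : IsPreconnected ray := isPreconnected_Ici.image _ (by fun_prop)
  by_contra! hno
  have hxf : x ∉ frontier s := by
    rw [hs.frontier_eq]; exact fun h => h.2 hx
  have hcover : ray ⊆ s ∪ (closure s)ᶜ := by
    rintro _ ⟨r, hr, rfl⟩
    by_contra hcon
    simp only [mem_union, mem_compl_iff, not_or, not_not] at hcon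
    have hmem : x + r • v ∈ frontier s := by
      rw [hs.frontier_eq]; exact ⟨hcon.2, hcon.1⟩
    rcases (mem_Ici.1 hr).eq_or_lt with h0 | h0
    · rw [← h0] at hmem
      simp only [zero_smul, add_zero] at hmem
      exact hxf hmem
    · exact hno r h0 hmem
  have hne1 : (ray ∩ s).Nonempty := ⟨x, ⟨0, by simp, by simp⟩, hx⟩
  have hne2 : (ray ∩ (closure s)ᶜ).Nonempty := by
    obtain ⟨R, hR⟩ := hb.closure.subset_closedBall x
    have hvn : 0 < ‖v‖ := norm_pos_iff.2 hv
    refine ⟨x + ((|R| + 1) / ‖v‖) • v, ⟨_, by simp only [mem_Ici]; positivity, rfl⟩, fun h => ?_⟩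
    have := hR h
    rw [mem_closedBall, dist_eq_norm, add_sub_cancel_left, norm_smul, Real.norm_of_nonneg
      (by positivity), div_mul_cancel₀ _ hvn.ne'] at this
    linarith [le_abs_self R]
  obtain ⟨z, -, hz1, hz2⟩ := hpre s (closure s)ᶜ hs isClosed_closure.isOpen_compl hcover hne1 hne2
  exact hz2 (subset_closure hz1)

/-- Convexity passes to the closure for functions continuous up to the boundary. -/
theorem ConvexOn.closure_of_continuousOn {F : Type*} [NormedAddCommGroup F] [NormedSpace ℝ F]
    {s : Set F} {u : F → ℝ} (hu : ConvexOn ℝ s u) (hc : ContinuousOn u (closure s)) :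
    ConvexOn ℝ (closure s) u := by
  refine ⟨hu.1.closure, fun x hx y hy a b ha hb hab => ?_⟩
  obtain ⟨xs, hxs, hxl⟩ := mem_closure_iff_seq_limit.1 hx
  obtain ⟨ys, hys, hyl⟩ := mem_closure_iff_seq_limit.1 hy
  have hlim : ∀ {zs : ℕ → F} {z : F}, (∀ n, zs n ∈ s) → z ∈ closure s →
      Tendsto zs atTop (𝓝 z) → Tendsto (fun n => u (zs n)) atTop (𝓝 (u z)) :=
    fun hzs hz hl => (hc _ hz).tendsto.comp
      (tendsto_nhdsWithin_iff.2 ⟨hl, Eventually.of_forall fun n => subset_closure (hzs n)⟩)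
  refine le_of_tendsto_of_tendsto'
    (hlim (fun n => hu.1 (hxs n) (hys n) ha hb hab) (hu.1.closure hx hy ha hb hab)
      ((hxl.const_smul a).add (hyl.const_smul b)))
    (((hlim hxs hx hxl).const_smul a).add ((hlim hys hy hyl).const_smul b))
    fun n => hu.2 (hxs n) (hys n) ha hb hab

/-- A convex function with zero boundary values on a bounded open set is nonpositive. -/
theorem ConvexOn.nonpos_of_frontier {F : Type*} [NormedAddCommGroup F] [NormedSpace ℝ F]
    [Nontrivial F] {s : Set F} {u : F → ℝ} (hs : IsOpen s) (hb : Bornology.IsBounded s)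
    (hu : ConvexOn ℝ (closure s) u) (h0 : ∀ x ∈ frontier s, u x = 0) {x : F}
    (hx : x ∈ closure s) : u x ≤ 0 := by
  by_cases hxs : x ∈ s
  · obtain ⟨v, hv⟩ := exists_ne (0 : F)
    obtain ⟨r, hr, hr'⟩ := hs.exists_add_smul_mem_frontier hb hxs hv
    obtain ⟨t, ht, ht'⟩ := hs.exists_add_smul_mem_frontier hb hxs (neg_ne_zero.2 hv)
    have h := hu.2 (frontier_subset_closure hr') (frontier_subset_closure ht')
      (show 0 ≤ t / (r + t) by positivity) (show 0 ≤ r / (r + t) by positivity)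
      (by field_simp; ring)
    have hcomb : (t / (r + t)) • (x + r • v) + (r / (r + t)) • (x + t • -v) = x := by
      have h1 : t / (r + t) + r / (r + t) = 1 := by field_simp; ring
      have h2 : (t / (r + t)) • (x + r • v) + (r / (r + t)) • (x + t • -v)
        = (t / (r + t) + r / (r + t)) • x := by module
      rw [h2, h1, one_smul]
    rw [hcomb, h0 _ hr', h0 _ ht'] at h
    simpa using h
  · exact (h0 x (by rw [hs.frontier_eq]; exact ⟨hx, hxs⟩)).le

/-- A nonzero convex function with zero boundary values is negative inside. -/
theorem ConvexOn.neg_of_frontier {F : Type*} [NormedAddCommGroup F] [NormedSpace ℝ F]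
    [Nontrivial F] {s : Set F} {u : F → ℝ} (hs : IsOpen s) (hb : Bornology.IsBounded s)
    (hu : ConvexOn ℝ (closure s) u) (h0 : ∀ x ∈ frontier s, u x = 0)
    (hne : ∃ x ∈ closure s, u x ≠ 0) {x : F} (hx : x ∈ s) : u x < 0 := by
  obtain ⟨p, hp, hup⟩ := hne
  have hup' : u p < 0 := lt_of_le_of_ne (hu.nonpos_of_frontier hs hb h0 hp) hup
  have hcont : Tendsto (fun r : ℝ => x + r • (x - p)) (𝓝[>] 0) (𝓝 x) := by
    have : Continuous fun r : ℝ => x + r • (x - p) := by fun_prop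
    have h := this.tendsto 0
    simp only [zero_smul, add_zero] at h
    exact h.mono_left nhdsWithin_le_nhds
  obtain ⟨r, hr, hr0⟩ := ((hcont.eventually (hs.mem_nhds hx)).and self_mem_nhdsWithin).exists
  replace hr : x + r • (x - p) ∈ s := hr
  replace hr0 : 0 < r := hr0
  have h := hu.2 hp (subset_closure hr) (show 0 ≤ r / (1 + r) by positivity)
    (show 0 ≤ 1 / (1 + r) by positivity) (by field_simp; ring)
  have hcomb : (r / (1 + r)) • p + (1 / (1 + r)) • (x + r • (x - p)) = x := by
    have h1 : 1 / (1 + r) * (1 + r) = 1 := by field_simp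
    have h2 : (r / (1 + r)) • p + (1 / (1 + r)) • (x + r • (x - p))
        = (1 / (1 + r) * (1 + r)) • x := by module
    rw [h2, h1, one_smul]
  rw [hcomb] at h
  have h1 := hu.nonpos_of_frontier hs hb h0 (subset_closure hr)
  simp only [smul_eq_mul] at h
  have h2 : r / (1 + r) * u p < 0 := mul_neg_of_pos_of_neg (by positivity) hup'
  have h3 : 1 / (1 + r) * u (x + r • (x - p)) ≤ 0 :=
    mul_nonpos_of_nonneg_of_nonpos (by positivity) h1
  linarith

/-- A convex function with zero boundary values that lies above a Lipschitz function with zero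
boundary values is Lipschitz up to the boundary. -/
theorem ConvexOn.lipschitzOnWith_of_le {F : Type*} [NormedAddCommGroup F]
    [InnerProductSpace ℝ F] [CompleteSpace F]
    {s : Set F} {u φ : F → ℝ} {K : NNReal} (hs : IsOpen s)
    (hb : Bornology.IsBounded s) (hconv : Convex ℝ s)
    (hu : ConvexOn ℝ (closure s) u) (hc : ContinuousOn u (closure s))
    (hd : DifferentiableOn ℝ u s) (h0 : ∀ x ∈ frontier s, u x = 0)
    (hφ : LipschitzOnWith K φ (closure s)) (hφ0 : ∀ x ∈ frontier s, φ x = 0)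
    (hle : ∀ x ∈ s, φ x ≤ u x) : LipschitzOnWith K u (closure s) := by
  rw [lipschitzOnWith_closure_iff hc]
  refine hconv.lipschitzOnWith_of_nnnorm_fderiv_le
    (fun x hx => hd.differentiableAt (hs.mem_nhds hx)) fun x hx => ?_
  have hdx := hd.differentiableAt (hs.mem_nhds hx)
  rw [← NNReal.coe_le_coe, coe_nnnorm, ← toDual_gradient, LinearIsometryEquiv.norm_map]
  by_cases hg : gradient u x = 0
  · simp [hg]
  obtain ⟨r, hr, hz⟩ := hs.exists_add_smul_mem_frontier hb hx hg
  have hgn : 0 < ‖gradient u x‖ := norm_pos_iff.2 hg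
  have h1 := hu.add_fderiv_le (subset_closure hx) (frontier_subset_closure hz) hdx.hasFDerivAt
  rw [h0 _ hz, add_sub_cancel_left, map_smul, ← inner_gradient_left,
    real_inner_self_eq_norm_sq, smul_eq_mul] at h1
  have h2 := hφ.dist_le_mul _ (subset_closure hx) _ (frontier_subset_closure hz)
  rw [hφ0 _ hz, dist_eq_norm, dist_eq_norm, sub_zero, sub_add_cancel_left, norm_neg, norm_smul,
    Real.norm_of_nonneg hr.le] at h2
  have h3 := hle x hx
  have h4 := neg_abs_le (φ x)
  rw [Real.norm_eq_abs] at h2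
  have h5 : (r * ‖gradient u x‖) * ‖gradient u x‖ ≤ (r * ‖gradient u x‖) * K := by nlinarith
  exact le_of_mul_le_mul_left h5 (by positivity)

end Domain

section Hessian

open Set Filter Topology
open scoped Gradient RealInnerProductSpace

/-- If the second derivative is bounded below by `κ ≥ 0`, the Hessian determinant is at least
`κ ^ n`. -/
theorem ContDiffAt.pow_le_det_fderiv_gradient {F : Type*} [NormedAddCommGroup F]
    [InnerProductSpace ℝ F] [FiniteDimensional ℝ F] {u : F → ℝ} {x : F} {κ : ℝ}
    (hu : ContDiffAt ℝ 2 u x) (hκ : 0 ≤ κ)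
    (hlow : ∀ v, κ * ‖v‖ ^ 2 ≤ fderiv ℝ (fderiv ℝ u) x v v) :
    κ ^ Module.finrank ℝ F ≤ (fderiv ℝ (∇ u) x).det := by
  have hsymm : (fderiv ℝ (∇ u) x : F →ₗ[ℝ] F).IsSymmetric := by
    intro v w
    rw [ContinuousLinearMap.coe_coe, hu.inner_fderiv_gradient, real_inner_comm,
      hu.inner_fderiv_gradient]
    exact hu.isSymmSndFDerivAt (by simp) v w
  rw [ContinuousLinearMap.det, hsymm.det_eq_prod_eigenvalues rfl]
  have heig : ∀ i, κ ≤ hsymm.eigenvalues rfl i := by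
    intro i
    have h := hlow (hsymm.eigenvectorBasis rfl i)
    rw [← hu.inner_fderiv_gradient, ← ContinuousLinearMap.coe_coe,
      hsymm.apply_eigenvectorBasis, inner_smul_left, real_inner_self_eq_norm_sq] at h
    simpa using h
  calc κ ^ Module.finrank ℝ F = ∏ _i : Fin (Module.finrank ℝ F), κ := by simp
    _ ≤ _ := by
      simp only [RCLike.ofReal_real_eq_id, id]
      exact Finset.prod_le_prod (fun _ _ => hκ) fun i _ => heig i

theorem det_fderiv_gradient_eq_det_hessian {d : ℕ} {u : EuclideanSpace ℝ (Fin d) → ℝ}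
    {x : EuclideanSpace ℝ (Fin d)} (hu : ContDiffAt ℝ 2 u x) :
    (fderiv ℝ (∇ u) x).det = (hessian d u x).det := by
  rw [ContinuousLinearMap.det, ← LinearMap.det_toMatrix (EuclideanSpace.basisFun (Fin d) ℝ).toBasis,
    ← Matrix.det_transpose]
  congr 1
  ext i j
  rw [Matrix.transpose_apply, LinearMap.toMatrix_apply]
  have h2 : HasFDerivAt (fun y => fderiv ℝ u y (EuclideanSpace.single j 1)) _ x :=
    (ContinuousLinearMap.apply ℝ ℝ (EuclideanSpace.single j (1 : ℝ))).hasFDerivAt.comp x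
      hu.differentiableAt_fderiv.hasFDerivAt
  have h1 := hu.inner_fderiv_gradient (EuclideanSpace.single i 1) (EuclideanSpace.single j 1)
  rw [EuclideanSpace.inner_single_right] at h1
  simp only [hessian, Matrix.of_apply, h2.fderiv]
  simpa using h1

theorem ConvexOn.det_hessian_nonneg {d : ℕ} {s : Set (EuclideanSpace ℝ (Fin d))}
    {u : EuclideanSpace ℝ (Fin d) → ℝ} {x : EuclideanSpace ℝ (Fin d)} (hu : ConvexOn ℝ s u)
    (hs : s ∈ 𝓝 x) (hd : ContDiffAt ℝ 2 u x) : 0 ≤ (hessian d u x).det := by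
  rw [← det_fderiv_gradient_eq_det_hessian hd]
  refine le_trans ?_ (hd.pow_le_det_fderiv_gradient le_rfl fun v => ?_)
  · positivity
  · simpa using hu.fderiv_fderiv_nonneg hs hd v

/-- A function with bounded Hessian determinant and zero boundary values lies above
a uniformly convex function with zero boundary values and larger Hessian determinant. -/
theorem le_of_det_hessian_lt {d : ℕ} {s : Set (EuclideanSpace ℝ (Fin d))}
    {u φ : EuclideanSpace ℝ (Fin d) → ℝ} {κ : ℝ} (hs : IsOpen s) (hb : Bornology.IsBounded s)
    (hc : ContinuousOn u (closure s)) (hd : ContDiffOn ℝ 2 u s)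
    (h0 : ∀ x ∈ frontier s, u x = 0)
    (hφ : ContDiff ℝ 2 φ) (hφ0 : ∀ x ∈ frontier s, φ x = 0) (hκ : 0 ≤ κ)
    (hlow : ∀ x v, κ * ‖v‖ ^ 2 ≤ fderiv ℝ (fderiv ℝ φ) x v v)
    (hdet : ∀ x ∈ s, (hessian d u x).det < κ ^ d) :
    ∀ x ∈ s, φ x ≤ u x := by
  intro x hx
  by_contra! hlt
  have hcomp : IsCompact (closure s) := hb.isCompact_closure
  obtain ⟨z, hz, hzmin⟩ := hcomp.exists_isMinOn ⟨x, subset_closure hx⟩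
    (hc.sub hφ.continuous.continuousOn)
  have hzneg : u z - φ z < 0 := (hzmin (subset_closure hx)).trans_lt (sub_neg.2 hlt)
  have hzs : z ∈ s := by
    by_contra hzs
    have hzf : z ∈ frontier s := by rw [hs.frontier_eq]; exact ⟨hz, hzs⟩
    rw [h0 z hzf, hφ0 z hzf] at hzneg
    simp at hzneg
  have hdz := hd.contDiffAt (hs.mem_nhds hzs)
  have hmin : IsLocalMin (fun y => u y - φ y) z :=
    (hzmin.on_subset subset_closure).isLocalMin (hs.mem_nhds hzs)
  refine (hdet z hzs).not_ge ?_
  rw [← det_fderiv_gradient_eq_det_hessian hdz]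
  have hge := hdz.pow_le_det_fderiv_gradient hκ fun v => ?_
  · simpa using hge
  · have h := hmin.fderiv_fderiv_nonneg (hdz.sub hφ.contDiffAt) v
    have heq : fderiv ℝ (fun y => u y - φ y) =ᶠ[𝓝 z] fun y => fderiv ℝ u y - fderiv ℝ φ y := by
      filter_upwards [hdz.eventually (by simp)] with y hy
      rw [fderiv_fun_sub (hy.differentiableAt (by simp))
        (hφ.contDiffAt.differentiableAt (by simp))]
    rw [heq.fderiv_eq, fderiv_fun_sub hdz.differentiableAt_fderiv
      hφ.contDiffAt.differentiableAt_fderiv] at h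
    simp only [sub_apply] at h
    linarith [hlow z v]

end Hessian

section ScaledGraph

open Set Filter Topology MeasureTheory
open scoped Gradient RealInnerProductSpace

variable {F : Type*} [NormedAddCommGroup F] [InnerProductSpace ℝ F]

/-- The map sending `(x, r)` to the point `(r ∇u(x), (r u)^*(r ∇u(x)))` of the graph of the
Legendre transform of `r u`. -/
noncomputable def scaledLegendreMap [CompleteSpace F] (u : F → ℝ) (z : F × ℝ) : F × ℝ :=
  (z.2 • ∇ u z.1, z.2 * (⟪∇ u z.1, z.1⟫ - u z.1))

/-- The derivative of `scaledLegendreMap`. -/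
noncomputable def scaledLegendreMapDeriv [CompleteSpace F] (u : F → ℝ) (z : F × ℝ) :
    F × ℝ →L[ℝ] F × ℝ :=
  ((z.2 • fderiv ℝ (∇ u) z.1).comp (ContinuousLinearMap.fst ℝ F ℝ) +
      (ContinuousLinearMap.snd ℝ F ℝ).smulRight (∇ u z.1)).prod
    ((z.2 • (innerSL ℝ z.1).comp (fderiv ℝ (∇ u) z.1)).comp (ContinuousLinearMap.fst ℝ F ℝ) +
      (⟪∇ u z.1, z.1⟫ - u z.1) • ContinuousLinearMap.snd ℝ F ℝ)

theorem hasFDerivAt_scaledLegendreMap [CompleteSpace F] {u : F → ℝ} {z : F × ℝ}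
    (hu : ContDiffAt ℝ 2 u z.1) :
    HasFDerivAt (scaledLegendreMap u) (scaledLegendreMapDeriv u z) z := by
  have hg : HasFDerivAt (fun y : F × ℝ => ∇ u y.1)
      ((fderiv ℝ (∇ u) z.1).comp (ContinuousLinearMap.fst ℝ F ℝ)) z :=
    hu.differentiableAt_gradient.hasFDerivAt.comp z hasFDerivAt_fst
  have hu' : HasFDerivAt (fun y : F × ℝ => u y.1)
      ((fderiv ℝ u z.1).comp (ContinuousLinearMap.fst ℝ F ℝ)) z :=
    (hu.differentiableAt (by simp)).hasFDerivAt.comp z hasFDerivAt_fst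
  have hs : HasFDerivAt (fun y : F × ℝ => y.2) (ContinuousLinearMap.snd ℝ F ℝ) z :=
    hasFDerivAt_snd
  have h := (hs.smul hg).prodMk (hs.mul ((hg.inner ℝ hasFDerivAt_fst).sub hu'))
  refine h.congr_fderiv ?_
  refine ContinuousLinearMap.ext fun ⟨ξ, σ⟩ => Prod.ext ?_ ?_
  · simp [scaledLegendreMapDeriv]
  · have h1 : fderiv ℝ u z.1 ξ = ⟪∇ u z.1, ξ⟫ := inner_gradient_left.symm
    have h2 : ⟪fderiv ℝ (∇ u) z.1 ξ, z.1⟫ = ⟪z.1, fderiv ℝ (∇ u) z.1 ξ⟫ := real_inner_comm _ _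
    simp [scaledLegendreMapDeriv, h1, h2, -inner_gradient_left, -inner_gradient_right]

theorem det_scaledLegendreMapDeriv [FiniteDimensional ℝ F] {u : F → ℝ} {z : F × ℝ}
    (hz : u z.1 ≠ 0) :
    (scaledLegendreMapDeriv u z).det =
      z.2 ^ Module.finrank ℝ F * (fderiv ℝ (∇ u) z.1).det * (-u z.1) := by
  set H := fderiv ℝ (∇ u) z.1 with hH
  set q := ∇ u z.1 with hq
  have hfac : (scaledLegendreMapDeriv u z : F × ℝ →ₗ[ℝ] F × ℝ) =
      LinearMap.transvection ((innerₗ F z.1).comp (LinearMap.fst ℝ F ℝ)) ((0 : F), (1 : ℝ)) ∘ₗ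
      LinearMap.transvection (LinearMap.snd ℝ F ℝ) ((-u z.1)⁻¹ • q, (0 : ℝ)) ∘ₗ
      LinearMap.prodMap (z.2 • (H : F →ₗ[ℝ] F)) ((-u z.1) • LinearMap.id) := by
    refine LinearMap.ext fun ⟨ξ, σ⟩ => Prod.ext ?_ ?_
    · simp [scaledLegendreMapDeriv, LinearMap.transvection.apply, ← hH, ← hq, smul_smul]
      field_simp
    · simp [scaledLegendreMapDeriv, LinearMap.transvection.apply, ← hH, ← hq, inner_add_right,
        inner_smul_right, real_inner_comm]
      field_simp
      ring
  rw [ContinuousLinearMap.det, hfac, LinearMap.det_comp, LinearMap.det_comp,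
    LinearMap.transvection.det, LinearMap.transvection.det, LinearMap.det_prodMap]
  simp [LinearMap.det_smul, ContinuousLinearMap.det]

end ScaledGraph

section LegendreImage

open Set Filter Topology MeasureTheory
open scoped Gradient RealInnerProductSpace

variable {F : Type*} [NormedAddCommGroup F] [InnerProductSpace ℝ F]

theorem ConvexOn.add_inner_gradient_le [CompleteSpace F] {s : Set F} {u : F → ℝ} {x y : F}
    (hu : ConvexOn ℝ s u) (hx : x ∈ s) (hy : y ∈ s) (hd : DifferentiableAt ℝ u x) :
    u x + (⟪∇ u x, y⟫ - ⟪∇ u x, x⟫) ≤ u y := by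
  have h := hu.add_fderiv_le hx hy hd.hasFDerivAt
  rw [← inner_gradient_left, inner_sub_right] at h
  exact h

theorem injOn_scaledLegendreMap [CompleteSpace F] {s : Set F} {w : F → ℝ} (hs : IsOpen s)
    (hw : ConvexOn ℝ s w) (hd : ContDiffOn ℝ 2 w s) (hneg : ∀ x ∈ s, w x < 0)
    (hinj : ∀ x ∈ s, Function.Injective (fderiv ℝ (∇ w) x)) :
    InjOn (scaledLegendreMap w) {z | z.1 ∈ s ∧ 0 < z.2} := by
  have hda : ∀ x ∈ s, DifferentiableAt ℝ w x := fun x hx =>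
    (hd.contDiffAt (hs.mem_nhds hx)).differentiableAt (by simp)
  have key : ∀ {x y : F} {r t : ℝ}, x ∈ s → y ∈ s → 0 < r → 0 < t →
      scaledLegendreMap w (x, r) = scaledLegendreMap w (y, t) → t ≤ r := by
    intro x y r t hx hy hr ht heq
    obtain ⟨h1, h2⟩ := Prod.ext_iff.1 heq
    simp only [scaledLegendreMap] at h1 h2
    have h3 := mul_le_mul_of_nonneg_left (hw.add_inner_gradient_le hy hx (hda y hy)) ht.le
    have h4 : r * ⟪∇ w x, x⟫ = t * ⟪∇ w y, x⟫ := by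
      rw [← real_inner_smul_left, h1, real_inner_smul_left]
    have h5 : t * -w x ≤ r * -w x := by linarith
    exact le_of_mul_le_mul_right h5 (neg_pos.2 (hneg x hx))
  rintro ⟨x, r⟩ ⟨hx, hr⟩ ⟨y, t⟩ ⟨hy, ht⟩ heq
  have hrt : r = t := le_antisymm (key hy hx ht hr heq.symm) (key hx hy hr ht heq)
  subst hrt
  have hg : ∇ w x = ∇ w y := by
    have h1 := (Prod.ext_iff.1 heq).1
    simp only [scaledLegendreMap] at h1
    exact smul_right_injective F (ne_of_gt hr) h1
  exact Prod.ext (hw.eq_of_gradient_eq hs hd hx hy hg (hinj x hx)) rfl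

/-- Linear functions stay strictly below the Legendre transform of a scaled strictly convex
function. -/
theorem inner_lt_scaledLegendreMap [CompleteSpace F] {s : Set F} {w : F → ℝ}
    (hs : IsOpen s) (hw : ConvexOn ℝ (closure s) w) (hconv : Convex ℝ s)
    (hd : ContDiffOn ℝ 2 w s)
    (hneg : ∀ x ∈ s, w x < 0) (h0 : ∀ x ∈ frontier s, w x = 0)
    (hinj : ∀ x ∈ s, Function.Injective (fderiv ℝ (∇ w) x)) {x y : F} {r : ℝ} (hx : x ∈ s)
    (hr : 0 < r) (hy : y ∈ closure s) :
    ⟪(scaledLegendreMap w (x, r)).1, y⟫ < (scaledLegendreMap w (x, r)).2 := by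
  have hda : ∀ x ∈ s, DifferentiableAt ℝ w x := fun x hx =>
    (hd.contDiffAt (hs.mem_nhds hx)).differentiableAt (by simp)
  have hxc := subset_closure hx
  simp only [scaledLegendreMap]
  rw [real_inner_smul_left, mul_lt_mul_iff_right₀ hr]
  have h1 := hw.add_inner_gradient_le hxc hy (hda x hx)
  by_cases hys : y ∈ s
  · linarith [hneg y hys]
  have hy0 : w y = 0 := h0 y (by rw [hs.frontier_eq]; exact ⟨hy, hys⟩)
  by_contra! hge
  set z := (2⁻¹ : ℝ) • x + (2⁻¹ : ℝ) • y with hz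
  have hzs : z ∈ s := by
    have := hconv.combo_interior_closure_mem_interior (by rwa [hs.interior_eq]) hy
      (show (0 : ℝ) < 2⁻¹ by norm_num) (show (0 : ℝ) ≤ 2⁻¹ by norm_num) (by norm_num)
    rwa [hs.interior_eq] at this
  have h2 := hw.2 hxc hy (show (0 : ℝ) ≤ 2⁻¹ by norm_num) (show (0 : ℝ) ≤ 2⁻¹ by norm_num)
    (by norm_num)
  rw [← hz, hy0] at h2
  simp only [smul_eq_mul] at h2
  have hzi : fderiv ℝ w x z = 2⁻¹ * ⟪∇ w x, x⟫ + 2⁻¹ * ⟪∇ w x, y⟫ := by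
    rw [← inner_gradient_left, hz, inner_add_right, real_inner_smul_right, real_inner_smul_right]
  have hmin : IsLocalMin (fun p => w p - fderiv ℝ w x p) z := by
    filter_upwards [hs.mem_nhds hzs] with p hp
    have h3 := hw.add_inner_gradient_le hxc (subset_closure hp) (hda x hx)
    rw [hzi, ← inner_gradient_left]
    linarith
  have h := hmin.fderiv_eq_zero
  rw [fderiv_fun_sub (hda z hzs) (ContinuousLinearMap.differentiableAt _),
    ContinuousLinearMap.fderiv, sub_eq_zero] at h
  have hxz : x = z := (hw.subset subset_closure hconv).eq_of_gradient_eq hs hd hx hzs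
    (by simp [gradient, h]) (hinj x hx)
  have hxy : x = y := by
    have h3 : (2⁻¹ : ℝ) • x = (2⁻¹ : ℝ) • y := by
      have h4 : x = (2⁻¹ : ℝ) • x + (2⁻¹ : ℝ) • x := by
        rw [← add_smul]; norm_num
      have h5 := h4.symm.trans (hxz.trans hz)
      exact add_left_cancel h5
    exact smul_right_injective F (show (2⁻¹ : ℝ) ≠ 0 by norm_num) h3
  exact hys (hxy ▸ hx)

/-- The image of the scaled Legendre map of `w` with scales in `(0, v / w)` is contained in
the image of the scaled Legendre map of `v` with scales in `(0, 1)`. -/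
theorem scaledLegendreMap_image_subset [FiniteDimensional ℝ F] {s : Set F}
    {v w : F → ℝ} (hs : IsOpen s) (hb : Bornology.IsBounded s) (hconv : Convex ℝ s)
    (hw : ConvexOn ℝ (closure s) w) (hd : ContDiffOn ℝ 2 w s)
    (hneg : ∀ x ∈ s, w x < 0) (h0 : ∀ x ∈ frontier s, w x = 0)
    (hinj : ∀ x ∈ s, Function.Injective (fderiv ℝ (∇ w) x))
    (hvc : ContinuousOn v (closure s)) (hvd : DifferentiableOn ℝ v s)
    (hv0 : ∀ x ∈ frontier s, v x = 0) :
    scaledLegendreMap w '' regionBetween (fun _ => 0) (fun x => v x / w x) s ⊆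
      scaledLegendreMap v '' regionBetween (fun _ => 0) (fun _ => 1) s := by
  rintro _ ⟨⟨x, r⟩, ⟨hx, hr, hvw⟩, rfl⟩
  simp only at hx hr hvw
  rw [lt_div_iff_of_neg (hneg x hx)] at hvw
  have hlt := fun y hy => inner_lt_scaledLegendreMap hs hw hconv hd hneg h0 hinj hx hr (y := y) hy
  have hτ : (scaledLegendreMap w (x, r)).2 =
      ⟪(scaledLegendreMap w (x, r)).1, x⟫ - r * w x := by
    simp only [scaledLegendreMap, real_inner_smul_left]; ring
  set p := (scaledLegendreMap w (x, r)).1 with hp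
  set τ := (scaledLegendreMap w (x, r)).2 with hτdef
  have hcomp : IsCompact (closure s) := hb.isCompact_closure
  have : CompactSpace (closure s) := isCompact_iff_compactSpace.1 hcomp
  have hvc' : Continuous fun y : closure s => v y := hvc.domRestrict
  set f : ℝ → closure s → ℝ := fun t y => ⟪p, (y : F)⟫ - t * v y with hf
  have hfcont : Continuous ↿f := by
    have : ↿f = fun q : ℝ × closure s => ⟪p, (q.2 : F)⟫ - q.1 * v q.2 := rfl
    rw [this]
    exact (continuous_const.inner (continuous_subtype_val.comp continuous_snd)).sub
      (continuous_fst.mul (hvc'.comp continuous_snd))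
  have hm : Continuous fun t => sSup (f t '' univ) :=
    isCompact_univ.continuous_sSup hfcont
  have hatt : ∀ t, ∃ y : closure s, sSup (f t '' univ) = f t y ∧ ∀ y', f t y' ≤ f t y := by
    intro t
    obtain ⟨y, -, hy, hy'⟩ := isCompact_univ.exists_sSup_image_eq_and_ge
      (⟨⟨x, subset_closure hx⟩, mem_univ _⟩)
      (hfcont.comp (Continuous.prodMk_right t)).continuousOn
    exact ⟨y, hy, fun y' => hy' y' (mem_univ _)⟩
  have hm0 : sSup (f 0 '' univ) < τ := by
    obtain ⟨y, hy, -⟩ := hatt 0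
    rw [hy]
    simpa [hf] using hlt y y.2
  have hm1 : τ < sSup (f 1 '' univ) := by
    obtain ⟨y, hy, hy'⟩ := hatt 1
    rw [hy]
    refine lt_of_lt_of_le ?_ (hy' ⟨x, subset_closure hx⟩)
    simp only [hf, hτ]
    linarith
  obtain ⟨t, ht, htτ⟩ := intermediate_value_Ioo zero_le_one hm.continuousOn ⟨hm0, hm1⟩
  obtain ⟨⟨y, hyc⟩, hy, hymax⟩ := hatt t
  have hyτ : ⟪p, y⟫ - t * v y = τ := hy.symm.trans htτ
  have hys : y ∈ s := by
    by_contra hys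
    have := hlt y hyc
    rw [hv0 y (by rw [hs.frontier_eq]; exact ⟨hyc, hys⟩)] at hyτ
    linarith
  have hdy := hvd.differentiableAt (hs.mem_nhds hys)
  have hlocmax : IsLocalMax (fun q => innerSL ℝ p q - t * v q) y := by
    filter_upwards [hs.mem_nhds hys] with q hq using hymax ⟨q, subset_closure hq⟩
  have hfd := hlocmax.fderiv_eq_zero
  rw [fderiv_fun_sub (ContinuousLinearMap.differentiableAt _) (hdy.const_mul t),
    ContinuousLinearMap.fderiv, fderiv_const_mul hdy, sub_eq_zero] at hfd
  have hpt : t • ∇ v y = p := by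
    refine ext_inner_right ℝ fun q => ?_
    rw [real_inner_smul_left, inner_gradient_left, ← innerSL_apply_apply ℝ p q, hfd]
    simp
  refine ⟨(y, t), ⟨hys, ht⟩, Prod.ext hpt ?_⟩
  change t * (⟪∇ v y, y⟫ - v y) = τ
  rw [mul_sub, ← real_inner_smul_left, hpt, hyτ]

end LegendreImage

section Volume

open Set Filter Topology MeasureTheory
open scoped Gradient RealInnerProductSpace ENNReal

theorem lintegral_Ioo_ofReal_pow_mul (n : ℕ) {a c : ℝ} (ha : 0 ≤ a) (hc : 0 ≤ c) :
    ∫⁻ r in Ioo 0 a, ENNReal.ofReal (r ^ n * c) = ENNReal.ofReal (a ^ (n + 1) / (n + 1) * c) := by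
  have hint : IntegrableOn (fun r : ℝ => r ^ n * c) (Ioo 0 a) :=
    ((by fun_prop : Continuous fun r : ℝ => r ^ n * c).integrableOn_Icc (a := 0) (b := a)).mono_set
      Ioo_subset_Icc_self
  rw [← ofReal_integral_eq_lintegral_ofReal hint, ← integral_Ioc_eq_integral_Ioo,
    ← intervalIntegral.integral_of_le ha, intervalIntegral.integral_mul_const, integral_pow]
  · simp
  · filter_upwards [ae_restrict_mem measurableSet_Ioo] with r hr
    have := hr.1
    positivity

theorem IsOpen.regionBetween_zero {F : Type*} [TopologicalSpace F] {s : Set F} {f : F → ℝ}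
    (hs : IsOpen s) (hf : ContinuousOn f s) : IsOpen (regionBetween (fun _ => 0) f s) := by
  have h1 : ContinuousOn (fun z : F × ℝ => f z.1 - z.2) (s ×ˢ Ioi 0) :=
    (hf.comp continuousOn_fst fun z hz => hz.1).sub continuousOn_snd
  convert h1.isOpen_inter_preimage (hs.prod isOpen_Ioi) (isOpen_Ioi (a := 0)) using 1
  ext z
  simp [regionBetween, and_assoc]

variable {F : Type*} [NormedAddCommGroup F] [InnerProductSpace ℝ F] [FiniteDimensional ℝ F]

theorem ContDiffOn.continuousOn_det_fderiv_gradient {s : Set F} {u : F → ℝ} (hs : IsOpen s)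
    (hu : ContDiffOn ℝ 2 u s) : ContinuousOn (fun x => (fderiv ℝ (∇ u) x).det) s := by
  have h1 : ContDiffOn ℝ 1 (∇ u) s :=
    (InnerProductSpace.toDual ℝ F).symm.toContinuousLinearEquiv.contDiff.comp_contDiffOn
      (hu.fderiv_of_isOpen hs one_add_one_eq_two.le)
  exact ContinuousLinearMap.continuous_det.comp_continuousOn
    (h1.continuousOn_fderiv_of_isOpen hs le_rfl)

theorem ContinuousLinearMap.injective_of_det_ne_zero {f : F →L[ℝ] F} (hf : f.det ≠ 0) :
    Function.Injective f :=
  ((f : F →ₗ[ℝ] F).equivOfDetNeZero hf).injective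

variable [MeasurableSpace F] [BorelSpace F] (μ : Measure F)

/-- The Jacobian of the scaled Legendre map integrates to a weighted Monge–Ampère energy. -/
theorem lintegral_det_scaledLegendreMapDeriv [SFinite μ] {s : Set F} {u f : F → ℝ} (hs : IsOpen s)
    (hu : ContDiffOn ℝ 2 u s) (hneg : ∀ x ∈ s, u x < 0) (hf : ContinuousOn f s)
    (hf0 : ∀ x ∈ s, 0 ≤ f x) :
    ∫⁻ z in regionBetween (fun _ => 0) f s,
        ENNReal.ofReal |(scaledLegendreMapDeriv u z).det| ∂(μ.prod volume) =
      ∫⁻ x in s, ENNReal.ofReal (f x ^ (Module.finrank ℝ F + 1) / (Module.finrank ℝ F + 1 : ℕ) *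
        (|(fderiv ℝ (∇ u) x).det| * -u x)) ∂μ := by
  set n := Module.finrank ℝ F with hn
  set S := regionBetween (fun _ => 0) f s with hS
  have hSo : IsOpen S := hs.regionBetween_zero hf
  set g : F × ℝ → ℝ≥0∞ := fun z =>
    ENNReal.ofReal (z.2 ^ n * (|(fderiv ℝ (∇ u) z.1).det| * -u z.1)) with hg
  have hgS : ∫⁻ z in S, ENNReal.ofReal |(scaledLegendreMapDeriv u z).det| ∂(μ.prod volume) =
      ∫⁻ z in S, g z ∂(μ.prod volume) := by
    refine setLIntegral_congr_fun hSo.measurableSet fun z hz => ?_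
    have hz2 : 0 < z.2 := hz.2.1
    have hun := hneg z.1 hz.1
    simp only [hg]
    rw [det_scaledLegendreMapDeriv hun.ne, abs_mul, abs_mul, abs_of_pos (neg_pos.2 hun),
      abs_of_pos (pow_pos hz2 _), mul_assoc]
  have hgm : AEMeasurable (S.indicator g) (μ.prod volume) := by
    rw [aemeasurable_indicator_iff hSo.measurableSet]
    refine (ContinuousOn.aemeasurable ?_ hSo.measurableSet).ennreal_ofReal
    have hmaps : MapsTo Prod.fst S s := fun z hz => hz.1
    exact (continuousOn_snd.pow n).mul
      (((hu.continuousOn_det_fderiv_gradient hs).comp continuousOn_fst hmaps).abs.mul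
        (hu.continuousOn.comp continuousOn_fst hmaps).neg)
  rw [hgS, ← lintegral_indicator hSo.measurableSet, lintegral_prod _ hgm,
    ← lintegral_indicator hs.measurableSet]
  congr 1
  ext x
  by_cases hx : x ∈ s
  · rw [indicator_of_mem hx]
    have hind : (fun r => S.indicator g (x, r)) = (Ioo 0 (f x)).indicator fun r => g (x, r) := by
      ext r
      simp [indicator, hS, regionBetween, hx]
    rw [hind, lintegral_indicator measurableSet_Ioo]
    have hc : 0 ≤ |(fderiv ℝ (∇ u) x).det| * -u x :=
      mul_nonneg (abs_nonneg _) (neg_pos.2 (hneg x hx)).le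
    rw [lintegral_Ioo_ofReal_pow_mul n (hf0 x hx) hc, Nat.cast_add, Nat.cast_one]
  · rw [indicator_of_notMem hx]
    have hind : (fun r => S.indicator g (x, r)) = fun _ => 0 := by
      ext r
      simp [indicator, hS, regionBetween, hx]
    rw [hind, lintegral_zero]

variable [μ.IsAddHaarMeasure]

/-- Comparison of weighted Monge–Ampère energies. -/
theorem lintegral_div_pow_mul_det_le {s : Set F}
    {v w : F → ℝ} (hs : IsOpen s) (hb : Bornology.IsBounded s) (hconv : Convex ℝ s)
    (hw : ConvexOn ℝ (closure s) w) (hwd : ContDiffOn ℝ 2 w s)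
    (hwneg : ∀ x ∈ s, w x < 0) (hw0 : ∀ x ∈ frontier s, w x = 0)
    (hinj : ∀ x ∈ s, Function.Injective (fderiv ℝ (∇ w) x))
    (hvc : ContinuousOn v (closure s)) (hvd : ContDiffOn ℝ 2 v s)
    (hvneg : ∀ x ∈ s, v x < 0) (hv0 : ∀ x ∈ frontier s, v x = 0) :
    ∫⁻ x in s, ENNReal.ofReal ((v x / w x) ^ (Module.finrank ℝ F + 1) *
        (|(fderiv ℝ (∇ w) x).det| * -w x)) ∂μ ≤
      ∫⁻ x in s, ENNReal.ofReal (|(fderiv ℝ (∇ v) x).det| * -v x) ∂μ := by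
  set n := Module.finrank ℝ F with hn
  have hda : ∀ {u : F → ℝ}, ContDiffOn ℝ 2 u s → ∀ {f : F → ℝ},
      ∀ z ∈ regionBetween (fun _ => 0) f s,
      HasFDerivWithinAt (scaledLegendreMap u) (scaledLegendreMapDeriv u z)
        (regionBetween (fun _ => 0) f s) z := fun hu _ z hz =>
    (hasFDerivAt_scaledLegendreMap (hu.contDiffAt (hs.mem_nhds hz.1))).hasFDerivWithinAt
  have hquot : ContinuousOn (fun x => v x / w x) s :=
    hvd.continuousOn.div hwd.continuousOn fun x hx => (hwneg x hx).ne
  have hcv := (hs.regionBetween_zero hquot).measurableSet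
  have hinjOn : InjOn (scaledLegendreMap w) (regionBetween (fun _ => 0) (fun x => v x / w x) s) :=
    (injOn_scaledLegendreMap hs (hw.subset subset_closure hconv) hwd hwneg hinj).mono
      fun _ hz => by exact ⟨hz.1, hz.2.1⟩
  have h1 := lintegral_abs_det_fderiv_eq_addHaar_image (μ.prod volume) hcv (hda hwd) hinjOn
  have h2 := addHaar_image_le_lintegral_abs_det_fderiv (μ.prod volume)
    (hs.regionBetween_zero (continuousOn_const (c := (1 : ℝ)))).measurableSet (hda hvd)
  have h3 := measure_mono (μ := μ.prod volume) (scaledLegendreMap_image_subset hs hb hconv hw hwd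
    hwneg hw0 hinj hvc (hvd.differentiableOn (by simp)) hv0)
  have h4 := h1.le.trans (h3.trans h2)
  rw [lintegral_det_scaledLegendreMapDeriv μ hs hwd hwneg hquot
      fun x hx => (div_pos_of_neg_of_neg (hvneg x hx) (hwneg x hx)).le,
    lintegral_det_scaledLegendreMapDeriv μ hs hvd hvneg continuousOn_const
      fun _ _ => zero_le_one, ← hn] at h4
  have hpos : (0 : ℝ) ≤ ((n + 1 : ℕ) : ℝ)⁻¹ := by positivity
  have hpull : ∀ h : F → ℝ, ∫⁻ x in s, ENNReal.ofReal (((n + 1 : ℕ) : ℝ)⁻¹ * h x) ∂μ =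
      ENNReal.ofReal (((n + 1 : ℕ) : ℝ)⁻¹) * ∫⁻ x in s, ENNReal.ofReal (h x) ∂μ := fun h => by
    rw [← lintegral_const_mul' _ _ ENNReal.ofReal_ne_top]
    simp_rw [ENNReal.ofReal_mul hpos]
  simp_rw [div_eq_inv_mul _ ((n + 1 : ℕ) : ℝ), mul_assoc, one_pow, one_mul] at h4
  rw [hpull, hpull] at h4
  refine (ENNReal.mul_le_mul_iff_right ?_ ENNReal.ofReal_ne_top).1 h4
  rw [ne_eq, ENNReal.ofReal_eq_zero, not_le]
  positivity

/-- The Monge–Ampère measure of a Lipschitz convex function is finite. -/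
theorem ConvexOn.integrableOn_det_fderiv_gradient {s : Set F} {u : F → ℝ} {K : NNReal}
    (hs : IsOpen s) (hu : ConvexOn ℝ s u) (hd : ContDiffOn ℝ 2 u s)
    (hK : LipschitzOnWith K u s) :
    IntegrableOn (fun x => (fderiv ℝ (∇ u) x).det) s μ := by
  have hcont := hd.continuousOn_det_fderiv_gradient hs
  refine ⟨hcont.aestronglyMeasurable hs.measurableSet, ?_⟩
  set T := s ∩ (fun x => (fderiv ℝ (∇ u) x).det) ⁻¹' {0}ᶜ with hT
  have hTo : IsOpen T := hcont.isOpen_inter_preimage hs isOpen_compl_singleton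
  have h1 : ∫⁻ x in s, ‖(fderiv ℝ (∇ u) x).det‖ₑ ∂μ =
      ∫⁻ x in T, ENNReal.ofReal |(fderiv ℝ (∇ u) x).det| ∂μ := by
    rw [← lintegral_indicator hs.measurableSet, ← lintegral_indicator hTo.measurableSet]
    congr 1
    ext x
    by_cases hx : x ∈ s
    · by_cases h0 : (fderiv ℝ (∇ u) x).det = 0
      · simp [indicator, hT, h0]
      · simp [indicator, hT, h0, hx, Real.enorm_eq_ofReal_abs]
    · simp [indicator, hT, hx]
  rw [hasFiniteIntegral_iff_enorm, h1,
    lintegral_abs_det_fderiv_eq_addHaar_image μ hTo.measurableSet (f := ∇ u)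
      (fun x hx => (hd.contDiffAt (hs.mem_nhds hx.1)).differentiableAt_gradient.hasFDerivAt
        |>.hasFDerivWithinAt)
      (fun x hx y hy hxy => hu.eq_of_gradient_eq hs hd hx.1 hy.1 hxy
        (ContinuousLinearMap.injective_of_det_ne_zero hx.2))]
  have hsub : ∇ u '' T ⊆ Metric.closedBall 0 K := by
    rintro _ ⟨x, hx, rfl⟩
    rw [mem_closedBall_zero_iff, ← (InnerProductSpace.toDual ℝ F).norm_map, toDual_gradient]
    exact norm_fderiv_le_of_lipschitzOn ℝ (hs.mem_nhds hx.1) hK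
  exact (measure_mono hsub).trans_lt measure_closedBall_lt_top

end Volume

section Eigenvalue

open Set Filter Topology MeasureTheory
open scoped Gradient RealInnerProductSpace

variable {d : ℕ} {s : Set (EuclideanSpace ℝ (Fin d))} {u w : EuclideanSpace ℝ (Fin d) → ℝ}

theorem ContDiff.fderiv_fderiv_apply {F : Type*} [NormedAddCommGroup F] [NormedSpace ℝ F]
    {φ : F → ℝ} (hφ : ContDiff ℝ 2 φ) (x v w : F) :
    fderiv ℝ (fun y => fderiv ℝ φ y v) x w = fderiv ℝ (fderiv ℝ φ) x w v := by
  have h : HasFDerivAt (fun y => fderiv ℝ φ y v) _ x :=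
    (ContinuousLinearMap.apply ℝ ℝ v).hasFDerivAt.comp x
      hφ.contDiffAt.differentiableAt_fderiv.hasFDerivAt
  rw [h.fderiv]
  rfl

theorem ContDiff.exists_lipschitzOnWith_of_isCompact {F : Type*} [NormedAddCommGroup F]
    [NormedSpace ℝ F] {φ : F → ℝ} (hφ : ContDiff ℝ 1 φ) {t : Set F} (ht : IsCompact t)
    (hconv : Convex ℝ t) : ∃ K : NNReal, LipschitzOnWith K φ t := by
  obtain ⟨C, hC⟩ := ht.exists_bound_of_continuousOn (hφ.continuous_fderiv one_ne_zero).continuousOn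
  refine ⟨C.toNNReal, hconv.lipschitzOnWith_of_nnnorm_fderiv_le
    (fun x _ => hφ.differentiable one_ne_zero x) fun x hx => ?_⟩
  rw [← NNReal.coe_le_coe, coe_nnnorm]
  exact (hC x hx).trans (Real.le_coe_toNNReal C)

theorem admissibleK.convexOn_closure (hu : u ∈ admissibleK d s) : ConvexOn ℝ (closure s) u :=
  hu.2.2.1.closure_of_continuousOn hu.1.choose_spec.continuousOn

theorem admissibleK.neg [Nontrivial (EuclideanSpace ℝ (Fin d))] (hu : u ∈ admissibleK d s)
    (hs : IsOpen s) (hb : Bornology.IsBounded s) {x : EuclideanSpace ℝ (Fin d)} (hx : x ∈ s) :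
    u x < 0 := by
  obtain ⟨p, hp, hup⟩ := hu.2.2.2.1
  exact (admissibleK.convexOn_closure hu).neg_of_frontier hs hb hu.2.2.2.2
    ⟨p, subset_closure hp, hup⟩ hx

theorem integral_neg_pow_pos (n : ℕ) (hs : IsOpen s) (hne : s.Nonempty)
    (hb : Bornology.IsBounded s) (hc : ContinuousOn u (closure s)) (hneg : ∀ x ∈ s, u x < 0) :
    IntegrableOn (fun x => (-u x) ^ n) s ∧ 0 < ∫ x in s, (-u x) ^ n := by
  have hint : IntegrableOn (fun x => (-u x) ^ n) s :=
    ((hc.neg.pow n).integrableOn_compact hb.isCompact_closure).mono_set subset_closure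
  refine ⟨hint, ?_⟩
  have hpos : ∀ x ∈ s, 0 < (-u x) ^ n := fun x hx => pow_pos (neg_pos.2 (hneg x hx)) n
  rw [setIntegral_pos_iff_support_of_nonneg_ae _ hint,
    inter_eq_right.2 (show s ⊆ Function.support fun x => (-u x) ^ n from
      fun x hx => (hpos x hx).ne')]
  · exact hs.measure_pos _ hne
  · filter_upwards [ae_restrict_mem hs.measurableSet] with x hx using (hpos x hx).le

theorem ConvexOn.integrableOn_neg_mul_det_hessian {K : NNReal} (hs : IsOpen s)
    (hb : Bornology.IsBounded s) (hu : ConvexOn ℝ s u) (hd : ContDiffOn ℝ 2 u s)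
    (hK : LipschitzOnWith K u (closure s)) :
    IntegrableOn (fun x => (-u x) * (hessian d u x).det) s := by
  have h1 := hu.integrableOn_det_fderiv_gradient volume hs hd (hK.mono subset_closure)
  obtain ⟨C, hC⟩ := hb.isCompact_closure.exists_bound_of_continuousOn hK.continuousOn
  have h2 : IntegrableOn (fun x => (-u x) * (fderiv ℝ (∇ u) x).det) s := by
    refine h1.bdd_mul (c := C) (hd.continuousOn.neg.aestronglyMeasurable hs.measurableSet) ?_
    filter_upwards [ae_restrict_mem hs.measurableSet] with x hx
    rw [norm_neg]
    exact hC x (subset_closure hx)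
  refine h2.congr_fun (fun x hx => ?_) hs.measurableSet
  simp only [det_fderiv_gradient_eq_det_hessian (hd.contDiffAt (hs.mem_nhds hx))]

/-- The eigenvalue is a lower bound for the Rayleigh quotient. -/
theorem IsMAEigenpair.le_rayleigh [Nontrivial (EuclideanSpace ℝ (Fin d))] {lam : ℝ}
    (hw : IsMAEigenpair d s lam w) (hlam : 0 < lam) (hs : IsOpen s) (hne : s.Nonempty)
    (hb : Bornology.IsBounded s) (hconv : Convex ℝ s) (hu : u ∈ admissibleK d s) :
    lam ≤ rayleigh d s u := by
  obtain ⟨hwc, hwd, hwconv, hwne, hweq, hw0⟩ := hw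
  have hneg : ∀ x ∈ s, u x < 0 := fun x hx => admissibleK.neg hu hs hb hx
  obtain ⟨⟨K, hK⟩, hud, huconv, -, hu0⟩ := hu
  have hwd2 : ContDiffOn ℝ 2 w s := contDiffOn_infty.1 hwd 2
  have hud2 : ContDiffOn ℝ 2 u s := contDiffOn_infty.1 hud 2
  have hwneg : ∀ x ∈ s, w x < 0 := fun x hx => hwconv.neg_of_frontier hs hb hw0 hwne hx
  have hdetw : ∀ x ∈ s, (fderiv ℝ (∇ w) x).det = lam * (-w x) ^ d := fun x hx => by
    rw [det_fderiv_gradient_eq_det_hessian (hwd2.contDiffAt (hs.mem_nhds hx)), hweq x hx,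
      abs_of_neg (hwneg x hx)]
  have hdetw0 : ∀ x ∈ s, 0 < (fderiv ℝ (∇ w) x).det := fun x hx => by
    rw [hdetw x hx]
    exact mul_pos hlam (pow_pos (neg_pos.2 (hwneg x hx)) d)
  have hdetu : ∀ x ∈ s, 0 ≤ (hessian d u x).det := fun x hx =>
    huconv.det_hessian_nonneg (hs.mem_nhds hx) (hud2.contDiffAt (hs.mem_nhds hx))
  have hle := lintegral_div_pow_mul_det_le volume hs hb hconv hwconv hwd2 hwneg hw0
    (fun x hx => ContinuousLinearMap.injective_of_det_ne_zero (hdetw0 x hx).ne')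
    hK.continuousOn hud2 hneg hu0
  rw [finrank_euclideanSpace, Fintype.card_fin] at hle
  obtain ⟨hint, hpos⟩ := integral_neg_pow_pos (d + 1) hs hne hb hK.continuousOn hneg
  have hleft : ∀ x ∈ s, (u x / w x) ^ (d + 1) * (|(fderiv ℝ (∇ w) x).det| * -w x) =
      lam * (-u x) ^ (d + 1) := fun x hx => by
    have hwx := neg_ne_zero.2 (hwneg x hx).ne
    rw [abs_of_pos (hdetw0 x hx), hdetw x hx, ← neg_div_neg_eq, div_pow]
    field_simp
    ring
  have hright : ∀ x ∈ s, |(fderiv ℝ (∇ u) x).det| * -u x = (-u x) * (hessian d u x).det :=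
    fun x hx => by
      rw [det_fderiv_gradient_eq_det_hessian (hud2.contDiffAt (hs.mem_nhds hx)),
        abs_of_nonneg (hdetu x hx), mul_comm]
  rw [setLIntegral_congr_fun hs.measurableSet fun x hx => congrArg ENNReal.ofReal (hleft x hx),
    setLIntegral_congr_fun hs.measurableSet fun x hx => congrArg ENNReal.ofReal (hright x hx),
    ← ofReal_integral_eq_lintegral_ofReal (hint.const_mul lam),
    ← ofReal_integral_eq_lintegral_ofReal
      (huconv.integrableOn_neg_mul_det_hessian hs hb hud2 hK),
    ENNReal.ofReal_le_ofReal_iff, integral_const_mul] at hle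
  · exact (le_div_iff₀ hpos).2 hle
  · exact setIntegral_nonneg hs.measurableSet fun x hx =>
      mul_nonneg (neg_pos.2 (hneg x hx)).le (hdetu x hx)
  · filter_upwards [ae_restrict_mem hs.measurableSet] with x hx
    exact mul_nonneg (neg_pos.2 (hneg x hx)).le (hdetu x hx)
  · filter_upwards [ae_restrict_mem hs.measurableSet] with x hx
    exact mul_nonneg hlam.le (pow_pos (neg_pos.2 (hneg x hx)) _).le

/-- The eigenvalue is the Rayleigh quotient of the eigenfunction. -/
theorem IsMAEigenpair.rayleigh_eq [Nontrivial (EuclideanSpace ℝ (Fin d))] {lam : ℝ}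
    (hw : IsMAEigenpair d s lam w) (hs : IsOpen s) (hne : s.Nonempty)
    (hb : Bornology.IsBounded s) : rayleigh d s w = lam := by
  obtain ⟨hwc, -, hwconv, hwne, hweq, hw0⟩ := hw
  have hwneg : ∀ x ∈ s, w x < 0 := fun x hx => hwconv.neg_of_frontier hs hb hw0 hwne hx
  have hpos := (integral_neg_pow_pos (d + 1) hs hne hb hwc hwneg).2
  have heq : ∫ x in s, (-w x) * (hessian d w x).det = ∫ x in s, lam * (-w x) ^ (d + 1) := by
    refine setIntegral_congr_fun hs.measurableSet fun x hx => ?_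
    simp only [hweq x hx, abs_of_neg (hwneg x hx)]
    ring
  rw [rayleigh, heq, integral_const_mul]
  exact mul_div_cancel_right₀ lam (ne_of_gt hpos)

/-- Eigenfunctions on smooth uniformly convex domains are Lipschitz up to the boundary. -/
theorem IsMAEigenpair.mem_admissibleK [Nontrivial (EuclideanSpace ℝ (Fin d))] {lam : ℝ}
    (hw : IsMAEigenpair d s lam w) (hlam : 0 < lam) (hd : d ≠ 0)
    (hΩ : SmoothBoundedUniformlyConvexDomain d s) : w ∈ admissibleK d s := by
  obtain ⟨hs, hb, ⟨p, hp⟩, hconv, φ, c, hc, hφ, hsφ, hlow⟩ := hΩ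
  obtain ⟨hwc, hwd, hwconv, hwne, hweq, hw0⟩ := hw
  have hwneg : ∀ x ∈ s, w x < 0 := fun x hx => hwconv.neg_of_frontier hs hb hw0 hwne hx
  have hwd2 : ContDiffOn ℝ 2 w s := contDiffOn_infty.1 hwd 2
  have hφ2 : ContDiff ℝ 2 φ := contDiff_infty.1 hφ 2
  have hφ0 : ∀ x ∈ frontier s, φ x = 0 := fun x hx => by
    rw [hsφ] at hx
    exact frontier_lt_subset_eq hφ.continuous continuous_const hx
  obtain ⟨M, hM⟩ := hb.isCompact_closure.exists_bound_of_continuousOn hwc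
  obtain ⟨A, hA⟩ : ∃ A : ℝ, 0 ≤ A ∧ lam * M ^ d < (A * c) ^ d := by
    have h1 : Tendsto (fun A : ℝ => (A * c) ^ d) atTop atTop :=
      (tendsto_pow_atTop hd).comp (tendsto_id.atTop_mul_const hc)
    exact ((eventually_ge_atTop 0).and (h1.eventually_gt_atTop _)).exists
  have hAφ : ContDiff ℝ 2 (A • φ) := contDiff_const.smul hφ2
  have hAφ0 : ∀ x ∈ frontier s, (A • φ) x = 0 := fun x hx => by simp [hφ0 x hx]
  obtain ⟨K, hK⟩ := (hAφ.of_le one_le_two).exists_lipschitzOnWith_of_isCompact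
    hb.isCompact_closure hconv.closure
  have hle : ∀ x ∈ s, (A • φ) x ≤ w x := by
    refine le_of_det_hessian_lt hs hb hwc hwd2 hw0 hAφ hAφ0 (mul_nonneg hA.1 hc.le)
      (fun x v => ?_) fun x hx => ?_
    · have h := hlow x v
      rw [hφ2.fderiv_fderiv_apply] at h
      have h2 : fderiv ℝ (A • φ) = A • fderiv ℝ φ := by
        ext1 y
        exact fderiv_const_smul (hφ2.differentiable two_ne_zero y) A
      rw [h2, fderiv_const_smul hφ2.contDiffAt.differentiableAt_fderiv, mul_assoc]
      exact mul_le_mul_of_nonneg_left h hA.1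
    · rw [hweq x hx]
      refine lt_of_le_of_lt ?_ hA.2
      gcongr
      exact hM x (subset_closure hx)
  refine ⟨⟨K, hwconv.lipschitzOnWith_of_le hs hb hconv hwc (hwd2.differentiableOn two_ne_zero)
    hw0 hK hAφ0 hle⟩, hwd, hwconv.subset subset_closure hconv, ⟨p, hp, (hwneg p hp).ne⟩, hw0⟩

end Eigenvalue

/-- On a smooth, bounded, uniformly convex domain `Ω ⊆ ℝ^d` (`d ≥ 2`), the Monge–Ampère
eigenvalue `λ_MA` is the infimum of the Rayleigh quotients over the admissible class `𝒦`. -/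
theorem monge_ampere_eigenvalue_eq_inf_rayleigh
    (d : ℕ) (hd : 2 ≤ d) (Ω : Set (EuclideanSpace ℝ (Fin d)))
    (hΩ : SmoothBoundedUniformlyConvexDomain d Ω)
    (lam : ℝ) (hlam : 0 < lam)
    (heig : ∃ u : EuclideanSpace ℝ (Fin d) → ℝ, IsMAEigenpair d Ω lam u) :
    lam = sInf (rayleigh d Ω '' admissibleK d Ω) := by
  obtain ⟨w, hw⟩ := heig
  have hd0 : d ≠ 0 := by omega
  have : Nontrivial (EuclideanSpace ℝ (Fin d)) :=
    Module.nontrivial_of_finrank_pos (R := ℝ) (by rw [finrank_euclideanSpace_fin]; omega)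
  obtain ⟨hs, hb, hne, hconv, -⟩ := id hΩ
  have hleast : IsLeast (rayleigh d Ω '' admissibleK d Ω) lam := by
    refine ⟨⟨w, hw.mem_admissibleK hlam hd0 hΩ, hw.rayleigh_eq hs hne hb⟩, ?_⟩
    rintro _ ⟨u, hu, rfl⟩
    exact hw.le_rayleigh hlam hs hne hb hconv hu
  exact hleast.csInf_eq.symm
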